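/- Let d ≥ 2 be an integer and let r, δ ∈ ℝ satisfy δ > 1, r ≤ 1, and d < 4δ − 2r − 2, and set k = 2(δ − r)/(1 − r + d/2). Then there exists a constant C > 0 such that for all measurable F, G, H : ℝ^d → [0,∞) with finite L² norms, Σ_{m=0}^∞ Σ_{n ∈ ℕ, n > km} I_{m,n}(F, G, H) ≤ C ‖F‖_{L²} ‖G‖_{L²} ‖H‖_{L²}. -/

import Mathlib

open MeasureTheory

/-- The function `μ_{r,δ}(ξ) = (|ξ₁| + |ξ|^δ)/|ξ|^r`. -/
noncomputable def muW (d : ℕ) (hd : 0 < d) (r δ : ℝ)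
    (ξ : EuclideanSpace ℝ (Fin d)) : ℝ :=
  (|ξ ⟨0, hd⟩| + ‖ξ‖ ^ δ) / ‖ξ‖ ^ r

/-- The region `E₁ ⊆ B(0,1)²` where `|ξ| + |η| > 3||ξ| - |η||`. -/
def E1set (d : ℕ) : Set (EuclideanSpace ℝ (Fin d) × EuclideanSpace ℝ (Fin d)) :=
  {p | ‖p.1‖ < 1 ∧ ‖p.2‖ < 1 ∧ 3 * |‖p.1‖ - ‖p.2‖| < ‖p.1‖ + ‖p.2‖}

/-- The dyadic region `E_{m,n} ⊆ E₁`. -/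
noncomputable def Emnset (d : ℕ) (m n : ℕ) :
    Set (EuclideanSpace ℝ (Fin d) × EuclideanSpace ℝ (Fin d)) :=
  {p | p ∈ E1set d ∧
    ((2 : ℝ) ^ (-(m : ℝ) - 1) < ‖p.1‖ ∧ ‖p.1‖ ≤ (2 : ℝ) ^ (-(m : ℝ))) ∧
    ((2 : ℝ) ^ (-(n : ℝ) + 1) < ‖p.1 + p.2‖ ∧ ‖p.1 + p.2‖ ≤ (2 : ℝ) ^ (-(n : ℝ) + 2))}

/-- The localized trilinear functional `I_{m,n}(F,G,H)`. -/
noncomputable def Imntri (d : ℕ) (hd : 0 < d) (r δ : ℝ) (m n : ℕ)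
    (F G H : EuclideanSpace ℝ (Fin d) → ℝ) : ENNReal :=
  ∫⁻ p in Emnset d m n,
    ENNReal.ofReal (muW d hd r δ (p.1 + p.2) / (muW d hd r δ p.1 * muW d hd r δ p.2)) *
      ENNReal.ofReal (F p.1) * ENNReal.ofReal (G p.2) * ENNReal.ofReal (H (p.1 + p.2))

open scoped ENNReal

section Helpers

/-- The norm annulus `{x : 2^{-j-1} < |x| ≤ 2^{-j}}`. -/
def dyadicAnnulus (E : Type*) [Norm E] (j : ℝ) : Set E :=
  {x | (2 : ℝ) ^ (-j - 1) < ‖x‖ ∧ ‖x‖ ≤ (2 : ℝ) ^ (-j)}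

lemma measurableSet_dyadicAnnulus {E : Type*} [NormedAddCommGroup E] [MeasurableSpace E]
    [BorelSpace E] (j : ℝ) : MeasurableSet (dyadicAnnulus E j) :=
  (measurableSet_lt measurable_const measurable_norm).inter
    (measurableSet_le measurable_norm measurable_const)

lemma disjoint_dyadicAnnulus {E : Type*} [Norm E] {i j : ℝ} (h : i + 1 ≤ j) :
    Disjoint (dyadicAnnulus E i) (dyadicAnnulus E j) := by
  rw [Set.disjoint_left]
  rintro x ⟨hi, -⟩ ⟨-, hj⟩
  have : (2 : ℝ) ^ (-j) ≤ 2 ^ (-i - 1) :=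
    Real.rpow_le_rpow_of_exponent_le one_le_two (by linarith)
  linarith

lemma tsum_setLIntegral_dyadicAnnulus_le {E : Type*} [NormedAddCommGroup E] [MeasurableSpace E]
    [BorelSpace E] (μ : Measure E) (f : E → ℝ≥0∞) (s : ℝ) :
    ∑' m : ℕ, ∫⁻ x in dyadicAnnulus E (m + s), f x ∂μ ≤ ∫⁻ x, f x ∂μ := by
  rw [← lintegral_iUnion (fun m => measurableSet_dyadicAnnulus _)]
  · exact setLIntegral_le_lintegral _ _
  · intro i j hij
    rcases lt_or_gt_of_ne hij with h | h
    · have : (i : ℝ) + 1 ≤ j := by exact_mod_cast h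
      exact disjoint_dyadicAnnulus (by linarith)
    · have : (j : ℝ) + 1 ≤ i := by exact_mod_cast h
      exact (disjoint_dyadicAnnulus (by linarith)).symm

/-- Three consecutive dyadic annuli. -/
def fatAnnulus (E : Type*) [Norm E] (j : ℝ) : Set E :=
  dyadicAnnulus E (j + -1) ∪ dyadicAnnulus E (j + 0) ∪ dyadicAnnulus E (j + 1)

lemma mem_fatAnnulus {E : Type*} [Norm E] {j : ℝ} {x : E}
    (h₁ : (2 : ℝ) ^ (-j - 2) < ‖x‖) (h₂ : ‖x‖ ≤ (2 : ℝ) ^ (-j + 1)) : x ∈ fatAnnulus E j := by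
  by_cases ha : ‖x‖ ≤ (2 : ℝ) ^ (-j - 1)
  · right
    constructor
    · convert h₁ using 2; ring
    · convert ha using 2; ring
  · by_cases hb : ‖x‖ ≤ (2 : ℝ) ^ (-j)
    · left; right
      constructor
      · simpa using ha
      · simpa using hb
    · left; left
      constructor
      · simpa using hb
      · convert h₂ using 2; ring

lemma measurableSet_fatAnnulus {E : Type*} [NormedAddCommGroup E] [MeasurableSpace E]
    [BorelSpace E] (j : ℝ) : MeasurableSet (fatAnnulus E j) :=
  ((measurableSet_dyadicAnnulus _).union (measurableSet_dyadicAnnulus _)).union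
    (measurableSet_dyadicAnnulus _)

lemma tsum_setLIntegral_fatAnnulus_le {E : Type*} [NormedAddCommGroup E] [MeasurableSpace E]
    [BorelSpace E] (μ : Measure E) (f : E → ℝ≥0∞) :
    ∑' m : ℕ, ∫⁻ x in fatAnnulus E m, f x ∂μ ≤ 3 * ∫⁻ x, f x ∂μ := by
  calc ∑' m : ℕ, ∫⁻ x in fatAnnulus E m, f x ∂μ
      ≤ ∑' m : ℕ, ((∫⁻ x in dyadicAnnulus E (m + -1), f x ∂μ) +
          (∫⁻ x in dyadicAnnulus E (m + 0), f x ∂μ) +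
          ∫⁻ x in dyadicAnnulus E (m + 1), f x ∂μ) := by
        refine ENNReal.tsum_le_tsum fun m => ?_
        refine (lintegral_union_le _ _ _).trans ?_
        gcongr
        exact lintegral_union_le _ _ _
    _ ≤ (∫⁻ x, f x ∂μ) + (∫⁻ x, f x ∂μ) + ∫⁻ x, f x ∂μ := by
        rw [ENNReal.tsum_add, ENNReal.tsum_add]
        gcongr <;> exact tsum_setLIntegral_dyadicAnnulus_le _ _ _
    _ = 3 * ∫⁻ x, f x ∂μ := by ring

lemma lintegral_mul_le_sqrt_mul_sqrt {α : Type*} [MeasurableSpace α] (μ : Measure α)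
    {f g : α → ℝ≥0∞} (hf : AEMeasurable f μ) (hg : AEMeasurable g μ) :
    ∫⁻ x, f x * g x ∂μ ≤
      (∫⁻ x, f x ^ 2 ∂μ) ^ (1 / 2 : ℝ) * (∫⁻ x, g x ^ 2 ∂μ) ^ (1 / 2 : ℝ) := by
  simpa using ENNReal.lintegral_mul_le_Lp_mul_Lq μ Real.HolderConjugate.two_two hf hg

lemma tsum_sqrt_mul_sqrt_le (a b : ℕ → ℝ≥0∞) :
    ∑' m, a m ^ (1 / 2 : ℝ) * b m ^ (1 / 2 : ℝ) ≤
      (∑' m, a m) ^ (1 / 2 : ℝ) * (∑' m, b m) ^ (1 / 2 : ℝ) := by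
  have h := lintegral_mul_le_sqrt_mul_sqrt Measure.count
    (f := fun m : ℕ => a m ^ (1 / 2 : ℝ)) (g := fun m : ℕ => b m ^ (1 / 2 : ℝ))
    (Measurable.of_discrete).aemeasurable (Measurable.of_discrete).aemeasurable
  have hsq : ∀ x : ℝ≥0∞, (x ^ (1 / 2 : ℝ)) ^ 2 = x := fun x => by
    rw [← ENNReal.rpow_natCast, ← ENNReal.rpow_mul]; norm_num
  simpa only [lintegral_count, hsq] using h

lemma lintegral_indicator_sq {α : Type*} [MeasurableSpace α] {μ : Measure α} {s : Set α}
    (u : α → ℝ≥0∞) (hs : MeasurableSet s) :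
    ∫⁻ x, s.indicator u x ^ 2 ∂μ = ∫⁻ x in s, u x ^ 2 ∂μ := by
  rw [← lintegral_indicator hs]
  refine lintegral_congr fun x => ?_
  by_cases hx : x ∈ s <;> simp [hx]

lemma lintegral_trilinear_le {E : Type*} [NormedAddCommGroup E] [MeasurableSpace E]
    [BorelSpace E] [SecondCountableTopology E] (μ : Measure E) [SFinite μ]
    [μ.IsAddLeftInvariant] [μ.IsNegInvariant] {f g h : E → ℝ≥0∞}
    (hf : Measurable f) (hg : Measurable g) (hh : Measurable h) :
    ∫⁻ p, f p.1 * g p.2 * h (p.1 + p.2) ∂(μ.prod μ) ≤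
      (∫⁻ x, f x ^ 2 ∂μ) ^ (1 / 2 : ℝ) * (∫⁻ x, g x ^ 2 ∂μ) ^ (1 / 2 : ℝ) * ∫⁻ x, h x ∂μ := by
  calc ∫⁻ p, f p.1 * g p.2 * h (p.1 + p.2) ∂(μ.prod μ)
      = ∫⁻ x, ∫⁻ y, f x * g y * h (x + y) ∂μ ∂μ := lintegral_prod _ (by fun_prop)
    _ = ∫⁻ x, ∫⁻ z, f x * g (z - x) * h z ∂μ ∂μ := by
        refine lintegral_congr fun x => ?_
        rw [← lintegral_add_left_eq_self (fun z => f x * g (z - x) * h z) x]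
        simp
    _ = ∫⁻ z, ∫⁻ x, f x * g (z - x) * h z ∂μ ∂μ := lintegral_lintegral_swap (by fun_prop)
    _ ≤ ∫⁻ z, (∫⁻ x, f x ^ 2 ∂μ) ^ (1 / 2 : ℝ) * (∫⁻ x, g x ^ 2 ∂μ) ^ (1 / 2 : ℝ) * h z ∂μ := by
        refine lintegral_mono fun z => ?_
        rw [lintegral_mul_const _ (by fun_prop)]
        gcongr
        refine (lintegral_mul_le_sqrt_mul_sqrt μ (by fun_prop) (by fun_prop)).trans_eq ?_
        rw [lintegral_sub_left_eq_self (fun x => g x ^ 2) z]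
    _ = _ := lintegral_const_mul _ hh

lemma tsum_ite_two_rpow_le {α x : ℝ} (hx : 0 ≤ x) (hα : 1 ≤ α) :
    ∑' n : ℕ, (if x < (n : ℝ) then ENNReal.ofReal ((2 : ℝ) ^ (-(α * (n - x)))) else 0) ≤ 2 := by
  rw [← Summable.sum_add_tsum_nat_add' (k := ⌊x⌋₊ + 1) ENNReal.summable, Finset.sum_eq_zero, zero_add]
  · calc _ ≤ ∑' i : ℕ, (2⁻¹ : ℝ≥0∞) ^ i := by
          refine ENNReal.tsum_le_tsum fun i => ?_
          have hlt := Nat.lt_floor_add_one x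
          split_ifs with h
          · have : (2⁻¹ : ℝ≥0∞) ^ i = ENNReal.ofReal ((2 : ℝ) ^ (-(i : ℝ))) := by
              rw [Real.rpow_neg two_pos.le, Real.rpow_natCast,
                ENNReal.ofReal_inv_of_pos (by positivity), ENNReal.ofReal_pow two_pos.le,
                ENNReal.inv_pow]
              simp
            rw [this]
            push_cast
            refine ENNReal.ofReal_le_ofReal
              (Real.rpow_le_rpow_of_exponent_le one_le_two (neg_le_neg ?_))
            nlinarith
          · exact zero_le
      _ = 2 := by rw [ENNReal.tsum_geometric, ENNReal.one_sub_inv_two, inv_inv]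
  · intro i hi
    rw [if_neg]
    have hi' : i ≤ ⌊x⌋₊ := by simpa [Nat.lt_succ_iff] using hi
    exact not_lt.2 ((Nat.le_floor_iff hx).1 hi')

end Helpers

lemma muW_le {d : ℕ} (hd : 0 < d) {r δ ρ : ℝ} (hδ : 1 < δ) (hr : r ≤ 1)
    {ξ : EuclideanSpace ℝ (Fin d)} (h0 : 0 < ‖ξ‖) (h2 : ‖ξ‖ ≤ 2) (hρ : ‖ξ‖ ≤ ρ) :
    muW d hd r δ ξ ≤ (1 + 2 ^ (δ - 1)) * ρ ^ (1 - r) := by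
  have h1 : |ξ ⟨0, hd⟩| ≤ ‖ξ‖ := by simpa using PiLp.norm_apply_le ξ ⟨0, hd⟩
  have h3 : ‖ξ‖ ^ δ ≤ 2 ^ (δ - 1) * ‖ξ‖ := by
    have : ‖ξ‖ ^ δ = ‖ξ‖ ^ (δ - 1) * ‖ξ‖ := by
      rw [← Real.rpow_add_one h0.ne', sub_add_cancel]
    rw [this]
    gcongr
  calc muW d hd r δ ξ ≤ ((1 + 2 ^ (δ - 1)) * ‖ξ‖) / ‖ξ‖ ^ r := by
        unfold muW
        gcongr
        linarith
    _ = (1 + 2 ^ (δ - 1)) * ‖ξ‖ ^ (1 - r) := by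
        rw [Real.rpow_sub h0, Real.rpow_one, mul_div_assoc]
    _ ≤ _ := by
        gcongr

lemma le_muW {d : ℕ} (hd : 0 < d) {r δ ρ : ℝ} (hrδ : r ≤ δ)
    {ξ : EuclideanSpace ℝ (Fin d)} (h0 : 0 < ρ) (hρ : ρ ≤ ‖ξ‖) :
    ρ ^ (δ - r) ≤ muW d hd r δ ξ := by
  have hξ : 0 < ‖ξ‖ := h0.trans_le hρ
  calc ρ ^ (δ - r) ≤ ‖ξ‖ ^ (δ - r) := by
        gcongr
    _ = ‖ξ‖ ^ δ / ‖ξ‖ ^ r := Real.rpow_sub hξ _ _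
    _ ≤ _ := by
        unfold muW
        gcongr
        linarith [abs_nonneg (ξ ⟨0, hd⟩)]

lemma muW_ratio_le {d : ℕ} (hd : 0 < d) {r δ : ℝ} (hδ : 1 < δ) (hr : r ≤ 1) {m n : ℕ}
    {p : EuclideanSpace ℝ (Fin d) × EuclideanSpace ℝ (Fin d)} (hp : p ∈ Emnset d m n) :
    muW d hd r δ (p.1 + p.2) / (muW d hd r δ p.1 * muW d hd r δ p.2) ≤
      (1 + 2 ^ (δ - 1)) * 2 ^ (2 * (1 - r) + 3 * (δ - r)) *
        2 ^ (-((1 - r) * n) + 2 * (δ - r) * m) := by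
  obtain ⟨⟨h1, h2, h3⟩, ⟨h4, -⟩, h6, h7⟩ := hp
  have hz : 0 < ‖p.1 + p.2‖ := (Real.rpow_pos_of_pos two_pos _).trans h6
  have hη : (2 : ℝ) ^ (-(m : ℝ) - 2) ≤ ‖p.2‖ := by
    have : (2 : ℝ) ^ (-(m : ℝ) - 1) = 2 ^ (-(m : ℝ) - 2) * 2 := by
      rw [← Real.rpow_add_one two_ne_zero]; congr 1; ring
    linarith [le_abs_self (‖p.1‖ - ‖p.2‖)]
  have hA := muW_le hd hδ hr hz ((norm_add_le _ _).trans (by linarith)) h7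
  have hB := le_muW hd (r := r) (δ := δ) (by linarith) (Real.rpow_pos_of_pos two_pos _) h4.le
  have hC := le_muW hd (r := r) (δ := δ) (by linarith) (Real.rpow_pos_of_pos two_pos _) hη
  refine (div_le_div₀ (by positivity) hA (by positivity)
    (mul_le_mul hB hC (by positivity) ((by positivity : (0 : ℝ) ≤ _).trans hB))).trans_eq ?_
  rw [mul_div_assoc, mul_assoc]
  congr 1
  simp only [← Real.rpow_mul two_pos.le, ← Real.rpow_add two_pos, ← Real.rpow_sub two_pos]
  congr 1
  ring

lemma lintegral_indicator_closedBall_le {d : ℕ} {ρ : ℝ} (hρ : 0 ≤ ρ)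
    {h : EuclideanSpace ℝ (Fin d) → ℝ≥0∞} (hh : Measurable h) :
    ∫⁻ x, (Metric.closedBall 0 ρ).indicator h x ≤
      ENNReal.ofReal (ρ ^ (d / 2 : ℝ)) *
        volume (Metric.ball (0 : EuclideanSpace ℝ (Fin d)) 1) ^ (1 / 2 : ℝ) *
        (∫⁻ x, h x ^ 2) ^ (1 / 2 : ℝ) := by
  rw [lintegral_indicator Metric.isClosed_closedBall.measurableSet]
  calc ∫⁻ x in Metric.closedBall 0 ρ, h x
      = ∫⁻ x in Metric.closedBall 0 ρ, 1 * h x := by simp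
    _ ≤ (∫⁻ _ in Metric.closedBall (0 : EuclideanSpace ℝ (Fin d)) ρ, 1 ^ 2) ^ (1 / 2 : ℝ) *
        (∫⁻ x in Metric.closedBall 0 ρ, h x ^ 2) ^ (1 / 2 : ℝ) :=
        lintegral_mul_le_sqrt_mul_sqrt _ (by fun_prop) (by fun_prop)
    _ ≤ _ := by
        gcongr
        · rw [one_pow, setLIntegral_one, Measure.addHaar_closedBall _ _ hρ,
            ENNReal.mul_rpow_of_nonneg _ _ (by norm_num), finrank_euclideanSpace_fin,
            ENNReal.ofReal_rpow_of_nonneg (by positivity) (by norm_num), ← Real.rpow_natCast,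
            ← Real.rpow_mul hρ, mul_one_div]
        · exact Measure.restrict_le_self

lemma measurableSet_Emnset (d m n : ℕ) : MeasurableSet (Emnset d m n) := by
  let P := EuclideanSpace ℝ (Fin d) × EuclideanSpace ℝ (Fin d)
  have hlt : ∀ u v : P → ℝ, Measurable u → Measurable v → MeasurableSet {p | u p < v p} :=
    fun u v => measurableSet_lt
  have hle : ∀ u v : P → ℝ, Measurable u → Measurable v → MeasurableSet {p | u p ≤ v p} :=
    fun u v => measurableSet_le
  exact ((hlt (fun p => ‖p.1‖) (fun _ => 1) (by fun_prop) (by fun_prop)).inter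
    ((hlt (fun p => ‖p.2‖) (fun _ => 1) (by fun_prop) (by fun_prop)).inter
      (hlt (fun p => 3 * |‖p.1‖ - ‖p.2‖|) (fun p => ‖p.1‖ + ‖p.2‖)
        (by fun_prop) (by fun_prop)))).inter
    (((hlt (fun _ => (2 : ℝ) ^ (-(m : ℝ) - 1)) (fun p => ‖p.1‖) (by fun_prop)
        (by fun_prop)).inter
      (hle (fun p => ‖p.1‖) (fun _ => (2 : ℝ) ^ (-(m : ℝ))) (by fun_prop) (by fun_prop))).inter
    ((hlt (fun _ => (2 : ℝ) ^ (-(n : ℝ) + 1)) (fun p => ‖p.1 + p.2‖) (by fun_prop)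
        (by fun_prop)).inter
      (hle (fun p => ‖p.1 + p.2‖) (fun _ => (2 : ℝ) ^ (-(n : ℝ) + 2)) (by fun_prop)
        (by fun_prop))))

lemma mem_of_mem_Emnset {d m n : ℕ}
    {p : EuclideanSpace ℝ (Fin d) × EuclideanSpace ℝ (Fin d)} (hp : p ∈ Emnset d m n) :
    p.1 ∈ dyadicAnnulus (EuclideanSpace ℝ (Fin d)) (m + 0) ∧
      p.2 ∈ fatAnnulus (EuclideanSpace ℝ (Fin d)) m ∧
      p.1 + p.2 ∈ Metric.closedBall (0 : EuclideanSpace ℝ (Fin d)) ((2 : ℝ) ^ (-(n : ℝ) + 2)) := by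
  obtain ⟨⟨-, -, h3⟩, ⟨h4, h5⟩, h6, h7⟩ := hp
  have e1 : (2 : ℝ) ^ (-(m : ℝ) - 1) = 2 ^ (-(m : ℝ) - 2) * 2 := by
    rw [← Real.rpow_add_one two_ne_zero]; congr 1; ring
  have e2 : (2 : ℝ) ^ (-(m : ℝ) + 1) = 2 ^ (-(m : ℝ)) * 2 :=
    Real.rpow_add_one two_ne_zero _
  have i1 : p.1 ∈ dyadicAnnulus (EuclideanSpace ℝ (Fin d)) (m + 0) := by
    rw [add_zero]; exact ⟨h4, h5⟩
  have i2 : p.2 ∈ fatAnnulus (EuclideanSpace ℝ (Fin d)) m :=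
    mem_fatAnnulus (by linarith [le_abs_self (‖p.1‖ - ‖p.2‖)])
      (by linarith [neg_abs_le (‖p.1‖ - ‖p.2‖)])
  have i3 : p.1 + p.2 ∈ Metric.closedBall (0 : EuclideanSpace ℝ (Fin d))
      ((2 : ℝ) ^ (-(n : ℝ) + 2)) := by simpa using h7
  exact ⟨i1, i2, i3⟩

lemma setLIntegral_Emnset_le {d : ℕ} (m n : ℕ) {f g h : EuclideanSpace ℝ (Fin d) → ℝ≥0∞}
    (hf : Measurable f) (hg : Measurable g) (hh : Measurable h) :
    ∫⁻ p in Emnset d m n, f p.1 * g p.2 * h (p.1 + p.2) ≤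
      (∫⁻ ξ in dyadicAnnulus (EuclideanSpace ℝ (Fin d)) (m + 0), f ξ ^ 2) ^ (1 / 2 : ℝ) *
        (∫⁻ ξ in fatAnnulus (EuclideanSpace ℝ (Fin d)) m, g ξ ^ 2) ^ (1 / 2 : ℝ) *
      (ENNReal.ofReal (((2 : ℝ) ^ (-(n : ℝ) + 2)) ^ (d / 2 : ℝ)) *
        volume (Metric.ball (0 : EuclideanSpace ℝ (Fin d)) 1) ^ (1 / 2 : ℝ) *
        (∫⁻ x, h x ^ 2) ^ (1 / 2 : ℝ)) := by
  have hρ : (0 : ℝ) ≤ 2 ^ (-(n : ℝ) + 2) := by positivity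
  have hball := lintegral_indicator_closedBall_le hρ hh
  have hin : ∀ p ∈ Emnset d m n, f p.1 * g p.2 * h (p.1 + p.2) ≤
      (dyadicAnnulus (EuclideanSpace ℝ (Fin d)) (m + 0)).indicator f p.1 *
        (fatAnnulus (EuclideanSpace ℝ (Fin d)) m).indicator g p.2 *
        (Metric.closedBall (0 : EuclideanSpace ℝ (Fin d))
          ((2 : ℝ) ^ (-(n : ℝ) + 2))).indicator h (p.1 + p.2) := fun p hp => by
    obtain ⟨i1, i2, i3⟩ := mem_of_mem_Emnset hp
    rw [Set.indicator_of_mem i1, Set.indicator_of_mem i2, Set.indicator_of_mem i3]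
  have htri := lintegral_trilinear_le (volume : Measure (EuclideanSpace ℝ (Fin d)))
    (hf.indicator (measurableSet_dyadicAnnulus (m + 0)))
    (hg.indicator (measurableSet_fatAnnulus m))
    (hh.indicator (Metric.isClosed_closedBall (x := 0)
      (ε := (2 : ℝ) ^ (-(n : ℝ) + 2))).measurableSet)
  rw [lintegral_indicator_sq _ (measurableSet_dyadicAnnulus _),
    lintegral_indicator_sq _ (measurableSet_fatAnnulus _), ← Measure.volume_eq_prod] at htri
  refine (setLIntegral_mono' (measurableSet_Emnset d m n) hin).trans ?_
  refine (setLIntegral_le_lintegral _ _).trans (htri.trans ?_)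
  exact mul_le_mul_right hball _

lemma Imntri_le {d : ℕ} (hd : 0 < d) {r δ : ℝ} (hδ : 1 < δ) (hr : r ≤ 1) (m n : ℕ)
    {F G H : EuclideanSpace ℝ (Fin d) → ℝ} (hF : Measurable F) (hG : Measurable G)
    (hH : Measurable H) :
    Imntri d hd r δ m n F G H ≤
      ENNReal.ofReal ((1 + 2 ^ (δ - 1)) * 2 ^ (2 * (1 - r) + 3 * (δ - r)) *
        2 ^ (-((1 - r) * n) + 2 * (δ - r) * m)) *
      (((∫⁻ ξ in dyadicAnnulus (EuclideanSpace ℝ (Fin d)) (m + 0),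
          ENNReal.ofReal (F ξ) ^ 2) ^ (1 / 2 : ℝ) *
        (∫⁻ ξ in fatAnnulus (EuclideanSpace ℝ (Fin d)) m,
          ENNReal.ofReal (G ξ) ^ 2) ^ (1 / 2 : ℝ)) *
      (ENNReal.ofReal (((2 : ℝ) ^ (-(n : ℝ) + 2)) ^ (d / 2 : ℝ)) *
        volume (Metric.ball (0 : EuclideanSpace ℝ (Fin d)) 1) ^ (1 / 2 : ℝ) *
        (∫⁻ x, ENNReal.ofReal (H x) ^ 2) ^ (1 / 2 : ℝ))) := by
  refine le_trans ?_ (mul_le_mul_right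
    (setLIntegral_Emnset_le m n hF.ennreal_ofReal hG.ennreal_ofReal hH.ennreal_ofReal) _)
  rw [← lintegral_const_mul _ (by fun_prop)]
  refine setLIntegral_mono' (measurableSet_Emnset d m n) fun p hp => ?_
  rw [← mul_assoc, ← mul_assoc]
  gcongr
  exact muW_ratio_le hd hδ hr hp

theorem stmt14 (d : ℕ) (hd : 2 ≤ d) (r δ : ℝ) (hδ : 1 < δ)
    (hr : r ≤ 1) (hdim : (d : ℝ) < 4 * δ - 2 * r - 2)
    (k : ℝ) (hk : k = 2 * (δ - r) / (1 - r + d / 2)) :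
    ∃ C : ℝ, 0 < C ∧ ∀ F G H : EuclideanSpace ℝ (Fin d) → ℝ,
      Measurable F → (∀ ξ, 0 ≤ F ξ) → Measurable G → (∀ ξ, 0 ≤ G ξ) →
      Measurable H → (∀ ξ, 0 ≤ H ξ) →
      (∫⁻ ξ, ENNReal.ofReal (F ξ) ^ 2) < ⊤ →
      (∫⁻ ξ, ENNReal.ofReal (G ξ) ^ 2) < ⊤ →
      (∫⁻ ξ, ENNReal.ofReal (H ξ) ^ 2) < ⊤ →
      (∑' m : ℕ, ∑' n : ℕ,
        if k * (m : ℝ) < (n : ℝ) then Imntri d (by omega) r δ m n F G H else 0) ≤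
        ENNReal.ofReal C * ((∫⁻ ξ, ENNReal.ofReal (F ξ) ^ 2) ^ (1/2 : ℝ) *
          ((∫⁻ ξ, ENNReal.ofReal (G ξ) ^ 2) ^ (1/2 : ℝ) *
           (∫⁻ ξ, ENNReal.ofReal (H ξ) ^ 2) ^ (1/2 : ℝ))) := by
  have hd0 : 0 < d := by omega
  have hd2 : (2 : ℝ) ≤ d := by exact_mod_cast hd
  set α : ℝ := 1 - r + d / 2 with hα
  have hα1 : 1 ≤ α := by linarith
  have hkα : α * k = 2 * (δ - r) := by
    rw [hk]; field_simp
  have hk0 : 0 ≤ k := by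
    rw [hk]; exact div_nonneg (by linarith) (by linarith)
  set V := volume (Metric.ball (0 : EuclideanSpace ℝ (Fin d)) 1) with hV
  have hVtop : V ≠ ⊤ := measure_ball_lt_top.ne
  set K : ℝ := (1 + 2 ^ (δ - 1)) * 2 ^ (2 * (1 - r) + 3 * (δ - r)) * 2 ^ (d : ℝ) with hK
  set C₀ : ℝ≥0∞ := 2 * 3 ^ (1 / 2 : ℝ) * ENNReal.ofReal K * V ^ (1 / 2 : ℝ) with hC₀
  have hC₀top : C₀ ≠ ⊤ := by
    have h3 : (3 : ℝ≥0∞) ^ (1 / 2 : ℝ) ≠ ⊤ :=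
      ENNReal.rpow_ne_top_of_nonneg (by norm_num) (by norm_num)
    have hV2 : V ^ (1 / 2 : ℝ) ≠ ⊤ := ENNReal.rpow_ne_top_of_nonneg (by norm_num) hVtop
    finiteness
  refine ⟨C₀.toReal + 1, by positivity, fun F G H hF _ hG _ hH _ _ _ _ => ?_⟩
  set NF := ∫⁻ ξ, ENNReal.ofReal (F ξ) ^ 2
  set NG := ∫⁻ ξ, ENNReal.ofReal (G ξ) ^ 2
  set NH := (∫⁻ ξ, ENNReal.ofReal (H ξ) ^ 2) ^ (1 / 2 : ℝ)
  set a : ℕ → ℝ≥0∞ := fun m => ∫⁻ ξ in dyadicAnnulus _ (m + 0), ENNReal.ofReal (F ξ) ^ 2 with ha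
  set b : ℕ → ℝ≥0∞ := fun m => ∫⁻ ξ in fatAnnulus _ m, ENNReal.ofReal (G ξ) ^ 2 with hb
  have hterm : ∀ m n : ℕ, Imntri d hd0 r δ m n F G H ≤
      (ENNReal.ofReal K * V ^ (1 / 2 : ℝ) * NH * (a m ^ (1 / 2 : ℝ) * b m ^ (1 / 2 : ℝ))) *
        ENNReal.ofReal ((2 : ℝ) ^ (-(α * (n - k * m)))) := fun m n => by
    refine (Imntri_le hd0 hδ hr m n hF hG hH).trans_eq ?_
    have hexp : ENNReal.ofReal ((1 + 2 ^ (δ - 1)) * 2 ^ (2 * (1 - r) + 3 * (δ - r)) *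
        2 ^ (-((1 - r) * n) + 2 * (δ - r) * m)) *
        ENNReal.ofReal (((2 : ℝ) ^ (-(n : ℝ) + 2)) ^ (d / 2 : ℝ)) =
        ENNReal.ofReal K * ENNReal.ofReal ((2 : ℝ) ^ (-(α * (n - k * m)))) := by
      rw [← ENNReal.ofReal_mul (by positivity), ← ENNReal.ofReal_mul (by positivity), hK]
      congr 1
      rw [mul_assoc, mul_assoc (_ * _)]
      congr 1
      rw [← Real.rpow_mul two_pos.le, ← Real.rpow_add two_pos, ← Real.rpow_add two_pos]
      congr 1
      linear_combination (-(m : ℝ)) * hkα + (n : ℝ) * hα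
    calc _ = (ENNReal.ofReal ((1 + 2 ^ (δ - 1)) * 2 ^ (2 * (1 - r) + 3 * (δ - r)) *
          2 ^ (-((1 - r) * n) + 2 * (δ - r) * m)) *
          ENNReal.ofReal (((2 : ℝ) ^ (-(n : ℝ) + 2)) ^ (d / 2 : ℝ))) *
          (a m ^ (1 / 2 : ℝ) * b m ^ (1 / 2 : ℝ) * V ^ (1 / 2 : ℝ) * NH) := by ring
      _ = _ := by rw [hexp]; ring
  calc _ ≤ ∑' m : ℕ, ∑' n : ℕ,
        (ENNReal.ofReal K * V ^ (1 / 2 : ℝ) * NH * (a m ^ (1 / 2 : ℝ) * b m ^ (1 / 2 : ℝ))) *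
        (if k * (m : ℝ) < (n : ℝ) then ENNReal.ofReal ((2 : ℝ) ^ (-(α * (n - k * m)))) else 0) := by
        refine ENNReal.tsum_le_tsum fun m => ENNReal.tsum_le_tsum fun n => ?_
        split_ifs
        · exact hterm m n
        · exact zero_le
    _ ≤ ∑' m : ℕ, (ENNReal.ofReal K * V ^ (1 / 2 : ℝ) * NH *
          (a m ^ (1 / 2 : ℝ) * b m ^ (1 / 2 : ℝ))) * 2 := by
        refine ENNReal.tsum_le_tsum fun m => ?_
        rw [ENNReal.tsum_mul_left]
        gcongr
        exact tsum_ite_two_rpow_le (by positivity) hα1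
    _ = ENNReal.ofReal K * V ^ (1 / 2 : ℝ) * NH * 2 *
          ∑' m : ℕ, a m ^ (1 / 2 : ℝ) * b m ^ (1 / 2 : ℝ) := by
        rw [← ENNReal.tsum_mul_left]
        exact tsum_congr fun m => by ring
    _ ≤ ENNReal.ofReal K * V ^ (1 / 2 : ℝ) * NH * 2 *
          (NF ^ (1 / 2 : ℝ) * (3 * NG) ^ (1 / 2 : ℝ)) := by
        gcongr
        refine (tsum_sqrt_mul_sqrt_le a b).trans ?_
        gcongr
        · exact tsum_setLIntegral_dyadicAnnulus_le _ _ _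
        · exact tsum_setLIntegral_fatAnnulus_le _ _
    _ = C₀ * (NF ^ (1 / 2 : ℝ) * (NG ^ (1 / 2 : ℝ) * NH)) := by
        rw [ENNReal.mul_rpow_of_nonneg _ _ (by norm_num), hC₀]
        ring
    _ ≤ _ := by
        gcongr
        rw [ENNReal.le_ofReal_iff_toReal_le hC₀top (by positivity)]
        linarith
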